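/- Let N ≥ 1 and u, u', v, v' ∈ ℂ, s = −(u+u'+v+v'), and let 𝒟^{(N)} be the matrix on GT_N built from (u,u',v,v'). Let λ ∈ GT_N with l_i = λ_i+N−i, and let μ = (μ_1 ≥ … ≥ μ_N ≥ 0) be a partition with at most N parts, m_j = μ_j+N−j, μ_{N+1} = 0. Then Σ_{ν∈GT_N} 𝒟^{(N)}(λ,ν) · F_{μ,v}(ν_1+N−1, …, ν_N) = (Σ_{j=1}^N m_j(m_j−1) + s·Σ_{j=1}^N m_j − d_N) · F_{μ,v}(l_1,…,l_N) + Σ_{j=1}^N ((m_j−1)(v'−v+m_j−1) + s(m_j−v−1) + uu'−vv') · [μ_j−1 ≥ μ_{j+1}] · F_{μ−e_j, v}(l_1,…,l_N), where the sum over ν has finitely many nonzero terms, [·] is the indicator, and μ−e_j is the partition obtained from μ by decreasing μ_j by 1. -/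

import Mathlib

/-- A signature of length `N`: a nonincreasing `N`-tuple of integers. -/
def Sig (N : ℕ) : Type := {f : Fin N → ℤ // ∀ i j : Fin N, i ≤ j → f j ≤ f i}

instance {N : ℕ} : DecidableEq (Sig N) := by unfold Sig; infer_instance

/-- Interlacing `ν ≺ λ` between a signature of length `N` and one of length `N+1`. -/
def Interlace {N : ℕ} (ν : Sig N) (lam : Sig (N + 1)) : Prop :=
  ∀ i : Fin N, lam.1 i.succ ≤ ν.1 i ∧ ν.1 i ≤ lam.1 i.castSucc

instance {N : ℕ} (ν : Sig N) (lam : Sig (N + 1)) : Decidable (Interlace ν lam) := by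
  unfold Interlace; infer_instance

/-- `∏_{i<j} (f i - i - f j + j)` (the Vandermonde-type product in shifted coordinates). -/
def vprod {N : ℕ} (f : Fin N → ℤ) : ℤ :=
  ∏ i : Fin N, ∏ j : Fin N,
    if i < j then (f i - (i : ℕ) - f j + (j : ℕ)) else 1

/-- The link (cotransition probability) `Λ^{N+1}_N(λ, ν)`. -/
noncomputable def link {N : ℕ} (lam : Sig (N + 1)) (ν : Sig N) : ℝ :=
  if Interlace ν lam then (Nat.factorial N : ℝ) * (vprod ν.1 : ℝ) / (vprod lam.1 : ℝ) else 0

/-- Shifted coordinates of a signature: `l_j = λ_j + N − j` (1-based), i.e.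
`lc λ i = λ_i + N − 1 − i` in 0-based indexing. -/
def lc {N : ℕ} (lam : Sig N) : Fin N → ℤ :=
  fun i => lam.1 i + (N : ℤ) - 1 - (i : ℕ)

/-- The Vandermonde product `∏_{i<j} (x_i − x_j)` (as a complex number). -/
def Vc {N : ℕ} (x : Fin N → ℤ) : ℂ :=
  ∏ i : Fin N, ∏ j : Fin N, if i < j then ((x i : ℂ) - (x j : ℂ)) else 1

/-- The one-dimensional bilateral birth-and-death rate matrix `𝒟` on `ℤ` with
parameters `(u,u',v,v')`. -/
def Dmat (u u' v v' : ℂ) (x y : ℤ) : ℂ :=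
  if y = x + 1 then ((x : ℂ) - u) * ((x : ℂ) - u')
  else if y = x - 1 then ((x : ℂ) + v) * ((x : ℂ) + v')
  else if y = x then -(((x : ℂ) - u) * ((x : ℂ) - u')) - ((x : ℂ) + v) * ((x : ℂ) + v')
  else 0

/-- The constant `d_N = N(N−1)(N−2)/3 − (u+u'+v+v')·N(N−1)/2`. -/
noncomputable def dConst (u u' v v' : ℂ) (N : ℕ) : ℂ :=
  (N : ℂ) * ((N : ℂ) - 1) * ((N : ℂ) - 2) / 3 -
    (u + u' + v + v') * ((N : ℂ) * ((N : ℂ) - 1)) / 2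

/-- The matrix `𝒟^{(N)}` of transition rates on `GT_N`:
`𝒟^{(N)}(λ,ν) = (V(n)/V(l)) Σ_i 𝒟(l_i,n_i)·[l_j = n_j ∀ j ≠ i] − d_N·[λ = ν]`. -/
noncomputable def DN (u u' v v' : ℂ) {N : ℕ} (lam ν : Sig N) : ℂ :=
  (Vc (lc ν) / Vc (lc lam)) *
      (∑ i : Fin N,
        if ∀ j : Fin N, j ≠ i → lc lam j = lc ν j then
          Dmat u u' v v' (lc lam i) (lc ν i) else 0) -
    (if lam = ν then dConst u u' v v' N else 0)

/-- The falling factorial `a^{↓k} = a(a−1)⋯(a−k+1)`. -/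
def ffall (a : ℂ) (k : ℕ) : ℂ := ∏ i ∈ Finset.range k, (a - (i : ℕ))

/-- The Pochhammer symbol `(a)_k = a(a+1)⋯(a+k−1)`. -/
def poch (a : ℂ) (k : ℕ) : ℂ := ∏ i ∈ Finset.range k, (a + (i : ℕ))

/-- `(a)_μ = ∏_{j=1}^N (a−j+1)_{μ_j}` for a partition `μ` with at most `N` parts. -/
def pochPar {N : ℕ} (a : ℂ) (μ : Fin N → ℕ) : ℂ :=
  ∏ i : Fin N, poch (a - (i : ℕ)) (μ i)

/-- The symmetric function
`F_{μ,c}(x_1,…,x_N) = (N)_μ^{−1} det[(x_i+c)^{↓(μ_j+N−j)}] / ∏_{i<j}(x_i−x_j)`. -/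
noncomputable def Ffun {N : ℕ} (μ : Fin N → ℕ) (c : ℂ) (x : Fin N → ℂ) : ℂ :=
  (pochPar (N : ℂ) μ)⁻¹ *
      Matrix.det (Matrix.of fun i j : Fin N => ffall (x i + c) (μ j + (N - 1 - (j : ℕ)))) /
    ∏ i : Fin N, ∏ j : Fin N, if i < j then (x i - x j) else 1

/-- The symmetric function
`G_{μ,c}(x_1,…,x_{N+1}) = (N+1)_μ^{−1} det[(x_i+c)^{↓(μ_j+N+1−j)}] / ∏_{i<j}(x_i−x_j)`,
with the convention `μ_{N+1} = 0`. -/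
noncomputable def Gfun {N : ℕ} (μ : Fin N → ℕ) (c : ℂ) (x : Fin (N + 1) → ℂ) : ℂ :=
  (pochPar ((N : ℂ) + 1) μ)⁻¹ *
      Matrix.det (Matrix.of fun i j : Fin (N + 1) =>
        ffall (x i + c) ((if h : (j : ℕ) < N then μ ⟨j, h⟩ else 0) + (N - (j : ℕ)))) /
    ∏ i : Fin (N + 1), ∏ j : Fin (N + 1), if i < j then (x i - x j) else 1

/-- The shifted coordinate `m_j = μ_j + N − j` of a partition (0-based: `μ_i + N − 1 − i`),
as a complex number. -/
def mS {N : ℕ} (μ : Fin N → ℕ) (j : Fin N) : ℂ :=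
  (μ j : ℂ) + (N : ℂ) - 1 - ((j : ℕ) : ℂ)

lemma ffall_succ (a : ℂ) (k : ℕ) : ffall a (k + 1) = ffall a k * (a - k) := by
  simp [ffall, Finset.prod_range_succ]

lemma ffall_succ_left (a : ℂ) (k : ℕ) : ffall a (k + 1) = a * ffall (a - 1) k := by
  unfold ffall
  rw [Finset.prod_range_succ', mul_comm]
  congr 1
  · simp
  · refine Finset.prod_congr rfl fun i _ => ?_
    push_cast
    ring

/-- The action of the one-dimensional difference operator on shifted falling factorials. -/
lemma birthDeath_ffall (u u' v v' x : ℂ) (m : ℕ) :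
    (x - u) * (x - u') * ffall (x + 1 + v) m + (x + v) * (x + v') * ffall (x - 1 + v) m
        + (-((x - u) * (x - u')) - (x + v) * (x + v')) * ffall (x + v) m
      = ((m : ℂ) * (m - 1) + -(u + u' + v + v') * m) * ffall (x + v) m
        + m * (((m : ℂ) - 1) * (v' - v + m - 1) + -(u + u' + v + v') * (m - v - 1)
            + u * u' - v * v') * ffall (x + v) (m - 1) := by
  cases m with
  | zero => simp [ffall]
  | succ k =>
    have h1 : ffall (x + 1 + v) (k + 1) = (x + 1 + v) * ffall (x + v) k := by
      rw [ffall_succ_left]; congr 2; ring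
    have h2 : ffall (x - 1 + v) (k + 1) = ffall (x - 1 + v) k * (x - 1 + v - k) := ffall_succ _ _
    have h3 := ffall_succ (x + v) k
    have h4 : (x + v) * ffall (x - 1 + v) k = ffall (x + v) k * (x + v - k) := by
      rw [← h3, ffall_succ_left]; congr 2; ring
    rw [h1, h2, h3, Nat.add_sub_cancel]
    push_cast
    linear_combination (x + v') * (x - 1 + v - k) * h4

/-- Perturbing a matrix row by row or column by column gives the same sum of determinants. -/
lemma Matrix.sum_det_updateRow_eq_sum_det_updateCol {n R : Type*} [Fintype n] [DecidableEq n]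
    [CommRing R] (A B : Matrix n n R) :
    ∑ i, (A.updateRow i (B i)).det = ∑ j, (A.updateCol j fun i => B i j).det := by
  have hr : ∀ i, (A.updateRow i (B i)).det = ∑ j, B i j * A.adjugate j i := by
    intro i
    rw [← Matrix.cramer_transpose_apply, Matrix.cramer_eq_adjugate_mulVec,
      ← Matrix.adjugate_transpose]
    simp [Matrix.mulVec, dotProduct, mul_comm]
  have hc : ∀ j, (A.updateCol j fun i => B i j).det = ∑ i, B i j * A.adjugate j i := by
    intro j
    rw [← Matrix.cramer_apply, Matrix.cramer_eq_adjugate_mulVec]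
    simp [Matrix.mulVec, dotProduct, mul_comm]
  simp_rw [hr, hc]
  exact Finset.sum_comm

lemma lc_strictAnti {N : ℕ} (lam : Sig N) : StrictAnti (lc lam) := by
  intro i j hij
  have h := lam.2 i j hij.le
  have : (i : ℕ) < j := hij
  simp only [lc]
  omega

lemma lc_injective {N : ℕ} : Function.Injective (lc : Sig N → Fin N → ℤ) := by
  intro a b h
  refine Subtype.ext (funext fun i => ?_)
  have := congrFun h i
  simp only [lc] at this
  omega

lemma exists_lc_eq {N : ℕ} {n : Fin N → ℤ} (hn : StrictAnti n) : ∃ ν : Sig N, lc ν = n := by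
  cases N with
  | zero => exact ⟨⟨n, fun i => i.elim0⟩, funext fun i => i.elim0⟩
  | succ N =>
    have h : Antitone fun i : Fin (N + 1) => n i - N + (i : ℕ) := by
      refine Fin.antitone_iff_succ_le.2 fun i => ?_
      have := hn (Fin.castSucc_lt_succ (i := i))
      simp only [Fin.val_succ, Fin.val_castSucc]
      push_cast
      omega
    refine ⟨⟨fun i => n i - N + (i : ℕ), fun i j hij => h hij⟩, funext fun i => ?_⟩
    simp only [lc]
    push_cast
    ring

lemma Vc_ne_zero {N : ℕ} {x : Fin N → ℤ} (hx : Function.Injective x) : Vc x ≠ 0 := by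
  refine Finset.prod_ne_zero_iff.2 fun i _ => Finset.prod_ne_zero_iff.2 fun j _ => ?_
  split_ifs with h
  · rw [sub_ne_zero]
    exact_mod_cast hx.ne h.ne
  · exact one_ne_zero

/-- The numerator matrix `[(x_i+c)^{↓(μ_j+N−j)}]` of `F_{μ,c}`. -/
def ffallMatrix {N : ℕ} (μ : Fin N → ℕ) (c : ℂ) (x : Fin N → ℂ) : Matrix (Fin N) (Fin N) ℂ :=
  Matrix.of fun i j => ffall (x i + c) (μ j + (N - 1 - (j : ℕ)))

lemma Vc_mul_Ffun {N : ℕ} (μ : Fin N → ℕ) (c : ℂ) {n : Fin N → ℤ} (hn : Function.Injective n) :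
    Vc n * Ffun μ c (fun i => (n i : ℂ))
      = (pochPar (N : ℂ) μ)⁻¹ * (ffallMatrix μ c fun i => (n i : ℂ)).det :=
  mul_div_cancel₀ _ (Vc_ne_zero hn)

lemma Ffun_eq_div_Vc {N : ℕ} (μ : Fin N → ℕ) (c : ℂ) (n : Fin N → ℤ) :
    Ffun μ c (fun i => (n i : ℂ))
      = (pochPar (N : ℂ) μ)⁻¹ * (ffallMatrix μ c fun i => (n i : ℂ)).det / Vc n := rfl

lemma injective_of_det_ffallMatrix_ne_zero {N : ℕ} {μ : Fin N → ℕ} {c : ℂ} {n : Fin N → ℤ}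
    (h : (ffallMatrix μ c fun i => (n i : ℂ)).det ≠ 0) : Function.Injective n := by
  intro i j hij
  by_contra hne
  refine h (Matrix.det_zero_of_row_eq hne ?_)
  funext k
  simp [ffallMatrix, hij]

lemma Dmat_ne_zero {u u' v v' : ℂ} {x y : ℤ} (h : Dmat u u' v v' x y ≠ 0) :
    y = x + 1 ∨ y = x - 1 ∨ y = x := by
  unfold Dmat at h
  split_ifs at h <;> tauto

/-- A unit perturbation of one coordinate keeps a strictly decreasing integer tuple strictly
decreasing as soon as it keeps it injective. -/
lemma strictAnti_of_perturb {N : ℕ} {l n : Fin N → ℤ} (hl : StrictAnti l)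
    (hn : Function.Injective n) {i : Fin N} (hi : n i = l i + 1 ∨ n i = l i - 1 ∨ n i = l i)
    (h : ∀ j, j ≠ i → l j = n j) : StrictAnti n := by
  intro a b hab
  have h1 := hl hab
  have h2 := hn.ne hab.ne
  by_cases ha : a = i
  · have := h b (by rintro rfl; exact hab.ne ha)
    subst ha
    omega
  · have := h a ha
    by_cases hb : b = i
    · subst hb
      omega
    · have := h b hb
      omega

/-- The transition weights applied to the antisymmetric numerator of `F_{μ,c}`, extended to all
integer tuples. -/
noncomputable def rowWeight {N : ℕ} (u u' v v' : ℂ) (l : Fin N → ℤ) (g : (Fin N → ℤ) → ℂ)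
    (i : Fin N) (n : Fin N → ℤ) : ℂ :=
  if ∀ j : Fin N, j ≠ i → l j = n j then Dmat u u' v v' (l i) (n i) * g n else 0

lemma rowWeight_ne_zero {N : ℕ} {u u' v v' : ℂ} {l : Fin N → ℤ} {g : (Fin N → ℤ) → ℂ}
    {i : Fin N} {n : Fin N → ℤ} (h : rowWeight u u' v v' l g i n ≠ 0) :
    (∀ j, j ≠ i → l j = n j) ∧ (n i = l i + 1 ∨ n i = l i - 1 ∨ n i = l i) ∧ g n ≠ 0 := by
  unfold rowWeight at h
  split_ifs at h with h1
  · exact ⟨h1, Dmat_ne_zero (left_ne_zero_of_mul h), right_ne_zero_of_mul h⟩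
  · exact absurd rfl h

lemma support_rowWeight_subset {N : ℕ} (u u' v v' : ℂ) (l : Fin N → ℤ) (g : (Fin N → ℤ) → ℂ)
    (i : Fin N) :
    Function.support (rowWeight u u' v v' l g i) ⊆
      ((({l i + 1, l i - 1, l i} : Finset ℤ).image (Function.update l i) :
        Finset (Fin N → ℤ)) : Set (Fin N → ℤ)) := by
  intro n hn
  obtain ⟨h1, h2, -⟩ := rowWeight_ne_zero hn
  have h3 : Function.update l i (n i) = n := by
    funext j
    by_cases hj : j = i
    · subst hj; simp
    · simp [hj, h1 j hj]
  rw [Finset.mem_coe, Finset.mem_image]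
  exact ⟨n i, by simpa using h2, h3⟩

lemma finsum_rowWeight {N : ℕ} (u u' v v' : ℂ) (l : Fin N → ℤ) (g : (Fin N → ℤ) → ℂ)
    (i : Fin N) :
    ∑ᶠ n, rowWeight u u' v v' l g i n
      = ((l i : ℂ) - u) * ((l i : ℂ) - u') * g (Function.update l i (l i + 1))
        + ((l i : ℂ) + v) * ((l i : ℂ) + v') * g (Function.update l i (l i - 1))
        + (-(((l i : ℂ) - u) * ((l i : ℂ) - u')) - ((l i : ℂ) + v) * ((l i : ℂ) + v')) * g l := by
  have key : ∀ x, rowWeight u u' v v' l g i (Function.update l i x)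
      = Dmat u u' v v' (l i) x * g (Function.update l i x) := by
    intro x
    unfold rowWeight
    rw [if_pos]
    · simp
    · intro j hj
      simp [hj]
  rw [finsum_eq_sum_of_support_subset _ (support_rowWeight_subset u u' v v' l g i),
    Finset.sum_image (Function.update_injective l i).injOn]
  simp_rw [key]
  rw [Finset.sum_insert, Finset.sum_insert, Finset.sum_singleton, ← add_assoc]
  · have e1 : ¬ (l i - 1 = l i + 1) := by omega
    have e2 : ¬ (l i = l i - 1) := by omega
    simp [Dmat, e1, e2]
  · simp
  · simp
    omega

lemma ffallMatrix_update_row {N : ℕ} (μ : Fin N → ℕ) (c : ℂ) (l : Fin N → ℤ) (i : Fin N)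
    (x : ℤ) :
    (ffallMatrix μ c fun k => ((Function.update l i x k : ℤ) : ℂ))
      = (ffallMatrix μ c fun k => (l k : ℂ)).updateRow i
          fun j => ffall (x + c) (μ j + (N - 1 - (j : ℕ))) := by
  ext a b
  by_cases h : a = i
  · subst h; simp [ffallMatrix]
  · simp [ffallMatrix, h]

/-- The one-dimensional operator applied to every variable of the numerator of `F_{μ,v}`. -/
lemma sum_finsum_rowWeight {N : ℕ} (u u' v v' : ℂ) (l : Fin N → ℤ) (μ : Fin N → ℕ) :
    ∑ i, ∑ᶠ n, rowWeight u u' v v' l (fun n => (ffallMatrix μ v fun k => (n k : ℂ)).det) i n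
      = ((∑ j, mS μ j * (mS μ j - 1)) + -(u + u' + v + v') * ∑ j, mS μ j)
          * (ffallMatrix μ v fun k => (l k : ℂ)).det
        + ∑ j, mS μ j * ((mS μ j - 1) * (v' - v + mS μ j - 1)
              + -(u + u' + v + v') * (mS μ j - v - 1) + u * u' - v * v')
            * ((ffallMatrix μ v fun k => (l k : ℂ)).updateCol j
                fun i => ffall (l i + v) (μ j + (N - 1 - (j : ℕ)) - 1)).det := by
  set A := ffallMatrix μ v fun k => (l k : ℂ) with hA
  have hm : ∀ j : Fin N, ((μ j + (N - 1 - (j : ℕ)) : ℕ) : ℂ) = mS μ j := by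
    intro j
    have h : (j : ℕ) + 1 ≤ N := j.2
    rw [Nat.sub_sub, Nat.cast_add, Nat.cast_sub (by omega), mS]
    push_cast
    ring
  let B : Matrix (Fin N) (Fin N) ℂ := Matrix.of fun i j =>
    (mS μ j * (mS μ j - 1) + -(u + u' + v + v') * mS μ j) * A i j
      + mS μ j * ((mS μ j - 1) * (v' - v + mS μ j - 1)
              + -(u + u' + v + v') * (mS μ j - v - 1) + u * u' - v * v')
            * ffall (l i + v) (μ j + (N - 1 - (j : ℕ)) - 1)
  have hrow : ∀ i, ∑ᶠ n, rowWeight u u' v v' l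
      (fun n => (ffallMatrix μ v fun k => (n k : ℂ)).det) i n = (A.updateRow i (B i)).det := by
    intro i
    rw [finsum_rowWeight, ffallMatrix_update_row, ffallMatrix_update_row, ← hA]
    have hB : B i = (((l i : ℂ) - u) * ((l i : ℂ) - u')) •
          (fun j => ffall (((l i + 1 : ℤ) : ℂ) + v) (μ j + (N - 1 - (j : ℕ))))
        + (((l i : ℂ) + v) * ((l i : ℂ) + v')) •
          (fun j => ffall (((l i - 1 : ℤ) : ℂ) + v) (μ j + (N - 1 - (j : ℕ))))
        + (-(((l i : ℂ) - u) * ((l i : ℂ) - u')) - ((l i : ℂ) + v) * ((l i : ℂ) + v')) • A i := by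
      funext j
      have := birthDeath_ffall u u' v v' (l i) (μ j + (N - 1 - (j : ℕ)))
      rw [hm] at this
      simp only [B, Matrix.of_apply, hA, ffallMatrix, Pi.add_apply, Pi.smul_apply, smul_eq_mul]
      push_cast
      linear_combination -this
    rw [hB, Matrix.det_updateRow_add, Matrix.det_updateRow_add, Matrix.det_updateRow_smul,
      Matrix.det_updateRow_smul, Matrix.det_updateRow_smul, Matrix.updateRow_eq_self]
  simp_rw [hrow]
  rw [Matrix.sum_det_updateRow_eq_sum_det_updateCol, Finset.mul_sum, ← Finset.sum_add_distrib,
    Finset.sum_mul, ← Finset.sum_add_distrib]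
  refine Finset.sum_congr rfl fun j _ => ?_
  have hB : (fun i => B i j) = (mS μ j * (mS μ j - 1) + -(u + u' + v + v') * mS μ j) •
        (fun i => A i j)
      + (mS μ j * ((mS μ j - 1) * (v' - v + mS μ j - 1)
              + -(u + u' + v + v') * (mS μ j - v - 1) + u * u' - v * v')) •
            fun i => ffall (l i + v) (μ j + (N - 1 - (j : ℕ)) - 1) := by
    funext i
    simp [B]
  rw [hB, Matrix.det_updateCol_add, Matrix.det_updateCol_smul, Matrix.det_updateCol_smul]
  congr 3
  exact Matrix.updateCol_eq_self A j

lemma poch_ne_zero_of_pos {a : ℕ} (ha : 0 < a) (k : ℕ) : poch (a : ℂ) k ≠ 0 := by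
  refine Finset.prod_ne_zero_iff.2 fun i _ => ?_
  exact_mod_cast (by omega : a + i ≠ 0)

lemma pochPar_ne_zero {N : ℕ} (μ : Fin N → ℕ) : pochPar (N : ℂ) μ ≠ 0 := by
  refine Finset.prod_ne_zero_iff.2 fun i _ => ?_
  rw [← Nat.cast_sub i.2.le]
  exact poch_ne_zero_of_pos (by omega) _

lemma pochPar_eq_mul_mS {N : ℕ} (μ : Fin N → ℕ) {j : Fin N} (hj : 0 < μ j) :
    pochPar (N : ℂ) μ = pochPar (N : ℂ) (Function.update μ j (μ j - 1)) * mS μ j := by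
  unfold pochPar
  rw [← Finset.mul_prod_erase _ _ (Finset.mem_univ j),
    ← Finset.mul_prod_erase _ (fun i => poch _ (Function.update μ j (μ j - 1) i))
      (Finset.mem_univ j)]
  have h1 : poch ((N : ℂ) - (j : ℕ)) (μ j)
      = poch ((N : ℂ) - (j : ℕ)) (Function.update μ j (μ j - 1) j) * mS μ j := by
    obtain ⟨k, hk⟩ : ∃ k, μ j = k + 1 := ⟨μ j - 1, by omega⟩
    simp only [Function.update_self, mS, hk, Nat.add_sub_cancel, poch, Finset.prod_range_succ]
    push_cast
    ring
  have h2 : ∏ i ∈ Finset.univ.erase j, poch ((N : ℂ) - (i : ℕ)) (Function.update μ j (μ j - 1) i)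
      = ∏ i ∈ Finset.univ.erase j, poch ((N : ℂ) - (i : ℕ)) (μ i) := by
    refine Finset.prod_congr rfl fun i hi => ?_
    rw [Function.update_of_ne (Finset.ne_of_mem_erase hi)]
  rw [h1, h2]
  ring

/-- Lowering the `j`-th column of the numerator: it yields `F_{μ−e_j,c}`, or vanishes when
`μ − e_j` is not a partition. -/
lemma mS_mul_det_updateCol {N : ℕ} (c : ℂ) (l : Fin N → ℤ) (μ : Fin N → ℕ)
    (hμ : ∀ i j : Fin N, i ≤ j → μ j ≤ μ i) (j : Fin N) :
    (pochPar (N : ℂ) μ)⁻¹ * (mS μ j * ((ffallMatrix μ c fun k => (l k : ℂ)).updateCol j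
        fun i => ffall (l i + c) (μ j + (N - 1 - (j : ℕ)) - 1)).det) / Vc l
      = if (if h : (j : ℕ) + 1 < N then μ ⟨(j : ℕ) + 1, h⟩ else 0) < μ j then
          Ffun (Function.update μ j (μ j - 1)) c (fun i => ((l i : ℤ) : ℂ)) else 0 := by
  by_cases hlt : (if h : (j : ℕ) + 1 < N then μ ⟨(j : ℕ) + 1, h⟩ else 0) < μ j
  · rw [if_pos hlt, Ffun_eq_div_Vc]
    have hpos : 0 < μ j := by omega
    have hP := pochPar_eq_mul_mS μ hpos
    have hm : mS μ j ≠ 0 := fun h => pochPar_ne_zero μ (by rw [hP, h, mul_zero])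
    have hM : (ffallMatrix μ c fun k => (l k : ℂ)).updateCol j
        (fun i => ffall (l i + c) (μ j + (N - 1 - (j : ℕ)) - 1))
          = ffallMatrix (Function.update μ j (μ j - 1)) c fun k => (l k : ℂ) := by
      ext a b
      by_cases hb : b = j
      · subst hb
        simp [ffallMatrix, Nat.sub_add_comm (show 1 ≤ μ b from hpos)]
      · simp [ffallMatrix, hb]
    rw [hM, hP, mul_inv, mul_assoc, inv_mul_cancel_left₀ hm]
  · rw [if_neg hlt]
    suffices h : mS μ j * ((ffallMatrix μ c fun k => (l k : ℂ)).updateCol j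
        fun i => ffall (l i + c) (μ j + (N - 1 - (j : ℕ)) - 1)).det = 0 by
      rw [h, mul_zero, zero_div]
    by_cases hj : (j : ℕ) + 1 < N
    · rw [dif_pos hj, not_lt] at hlt
      have heq : μ ⟨(j : ℕ) + 1, hj⟩ = μ j := le_antisymm (hμ _ _ (Nat.le_succ _)) hlt
      have hne : (⟨(j : ℕ) + 1, hj⟩ : Fin N) ≠ j := fun h => by
        have := congrArg Fin.val h
        simp at this
      refine mul_eq_zero_of_right _ (Matrix.det_zero_of_column_eq hne fun k => ?_)
      rw [Matrix.updateCol_self, Matrix.updateCol_ne hne]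
      simp only [ffallMatrix, Matrix.of_apply, heq]
      congr 1
      omega
    · rw [dif_neg hj, not_lt, Nat.le_zero] at hlt
      have hN : (N : ℂ) = (j : ℕ) + 1 := by exact_mod_cast (by omega : N = j + 1)
      rw [mS, hlt, hN]
      push_cast
      ring

/-- Lemma 4.5 of Borodin–Olshanski: the action of `𝒟^{(N)}` on the functions
`F_{μ,v}` evaluated at shifted coordinates, with `s = −(u+u'+v+v')`:
`Σ_ν 𝒟^{(N)}(λ,ν) F_{μ,v}(ν₁+N−1,…,ν_N)
 = (Σ_j m_j(m_j−1) + s Σ_j m_j − d_N) F_{μ,v}(l)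
 + Σ_j ((m_j−1)(v'−v+m_j−1) + s(m_j−v−1) + uu'−vv')·[μ_j−1 ≥ μ_{j+1}]·F_{μ−e_j,v}(l)`. -/
theorem stmt13 (N : ℕ) (hN : 1 ≤ N) (u u' v v' : ℂ) (lam : Sig N)
    (μ : Fin N → ℕ) (hμ : ∀ i j : Fin N, i ≤ j → μ j ≤ μ i) :
    ∑ᶠ ν : Sig N, DN u u' v v' lam ν * Ffun μ v (fun i => ((lc ν i : ℤ) : ℂ))
      = ((∑ j : Fin N, mS μ j * (mS μ j - 1)) +
            (-(u + u' + v + v')) * (∑ j : Fin N, mS μ j) - dConst u u' v v' N) *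
          Ffun μ v (fun i => ((lc lam i : ℤ) : ℂ)) +
        ∑ j : Fin N,
          (if (if h : (j : ℕ) + 1 < N then μ ⟨(j : ℕ) + 1, h⟩ else 0) < μ j then
            ((mS μ j - 1) * (v' - v + mS μ j - 1) +
                (-(u + u' + v + v')) * (mS μ j - v - 1) + u * u' - v * v') *
              Ffun (Function.update μ j (μ j - 1)) v (fun i => ((lc lam i : ℤ) : ℂ))
          else 0) := by
  classical
  set l := lc lam with hl
  set g : (Fin N → ℤ) → ℂ := fun n => (ffallMatrix μ v fun k => (n k : ℂ)).det with hg
  set P := (pochPar (N : ℂ) μ)⁻¹ with hP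
  have hfin : ∀ i, (Function.support (rowWeight u u' v v' l g i)).Finite := fun i =>
    (Finset.finite_toSet _).subset (support_rowWeight_subset u u' v v' l g i)
  let T : (Fin N → ℤ) → ℂ := fun n =>
    P / Vc l * (∑ i, rowWeight u u' v v' l g i n)
      - if n = l then dConst u u' v v' N * Ffun μ v (fun i => (l i : ℂ)) else 0
  have hterm : ∀ ν : Sig N,
      DN u u' v v' lam ν * Ffun μ v (fun i => ((lc ν i : ℤ) : ℂ)) = T (lc ν) := by
    intro ν
    have hF := Vc_mul_Ffun μ v (lc_strictAnti ν).injective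
    have hsum : ∑ i, rowWeight u u' v v' l g i (lc ν)
        = (∑ i : Fin N, if ∀ j : Fin N, j ≠ i → lc lam j = lc ν j then
          Dmat u u' v v' (lc lam i) (lc ν i) else 0) * g (lc ν) := by
      rw [Finset.sum_mul]
      refine Finset.sum_congr rfl fun i _ => ?_
      rw [ite_mul, zero_mul]
      rfl
    have hd : (if lam = ν then dConst u u' v v' N else 0)
          * Ffun μ v (fun i => ((lc ν i : ℤ) : ℂ))
        = if lc ν = l then dConst u u' v v' N * Ffun μ v (fun i => (l i : ℂ)) else 0 := by
      by_cases h : lam = ν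
      · subst h
        simp [hl]
      · have h' : lc ν ≠ l := fun e => h (lc_injective e).symm
        simp [h, h']
    simp only [T, DN, sub_mul, hd, hsum]
    congr 1
    rw [← hl]
    simp only [hg, hP]
    linear_combination (∑ i : Fin N, if ∀ j : Fin N, j ≠ i → l j = lc ν j then
          Dmat u u' v v' (l i) (lc ν i) else 0) / Vc l * hF
  have hzero : ∀ n, n ∉ Set.range (lc : Sig N → Fin N → ℤ) → T n = 0 := by
    intro n hn
    have h1 : n ≠ l := fun h => hn ⟨lam, h.symm⟩
    have h2 : ∀ i, rowWeight u u' v v' l g i n = 0 := by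
      intro i
      by_contra h
      obtain ⟨ha, hb, hc⟩ := rowWeight_ne_zero h
      exact hn (exists_lc_eq (strictAnti_of_perturb (lc_strictAnti lam)
        (injective_of_det_ffallMatrix_ne_zero hc) hb ha))
    simp [T, h1, h2]
  have hT : ∑ᶠ ν : Sig N, T (lc ν) = ∑ᶠ n, T n := by
    rw [← finsum_mem_range lc_injective]
    refine finsum_congr fun n => ?_
    by_cases h : n ∈ Set.range (lc : Sig N → Fin N → ℤ)
    · rw [finsum_eq_if, if_pos h]
    · rw [finsum_eq_if, if_neg h, hzero n h]
  have hsumfin : (Function.support fun n => ∑ i, rowWeight u u' v v' l g i n).Finite := by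
    refine (Set.finite_iUnion hfin).subset fun n hn => ?_
    obtain ⟨i, -, hi⟩ := Finset.exists_ne_zero_of_sum_ne_zero hn
    exact Set.mem_iUnion.2 ⟨i, hi⟩
  have hsplit : ∑ᶠ n, T n = P / Vc l * (∑ i, ∑ᶠ n, rowWeight u u' v v' l g i n)
      - dConst u u' v v' N * Ffun μ v (fun i => (l i : ℂ)) := by
    rw [finsum_sub_distrib, ← mul_finsum, finsum_sum_comm _ _ fun i _ => hfin i]
    · congr 1
      rw [finsum_eq_single _ l fun n hn => if_neg hn, if_pos rfl]
    · exact hsumfin.subset fun n hn => right_ne_zero_of_mul hn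
    · refine (Set.finite_singleton l).subset fun n hn => ?_
      by_contra h
      exact hn (if_neg h)
  rw [finsum_congr hterm, hT, hsplit, hg, sum_finsum_rowWeight]
  have hcol : ∀ j : Fin N, P / Vc l * (mS μ j * ((mS μ j - 1) * (v' - v + mS μ j - 1)
              + -(u + u' + v + v') * (mS μ j - v - 1) + u * u' - v * v')
            * ((ffallMatrix μ v fun k => (l k : ℂ)).updateCol j
                fun i => ffall (l i + v) (μ j + (N - 1 - (j : ℕ)) - 1)).det)
      = if (if h : (j : ℕ) + 1 < N then μ ⟨(j : ℕ) + 1, h⟩ else 0) < μ j then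
            ((mS μ j - 1) * (v' - v + mS μ j - 1) +
                (-(u + u' + v + v')) * (mS μ j - v - 1) + u * u' - v * v') *
              Ffun (Function.update μ j (μ j - 1)) v (fun i => ((l i : ℤ) : ℂ))
          else 0 := by
    intro j
    rw [← mul_ite_zero, ← mS_mul_det_updateCol v l μ hμ j]
    ring
  rw [← Finset.sum_congr rfl fun j _ => hcol j, ← Finset.mul_sum, Ffun_eq_div_Vc]
  ring
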